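/- Let R be a Prüfer v-multiplication domain that is not a field, let x be a nonzero nonunit of R, let P be a prime ideal of R minimal over xR, let M be a maximal t-ideal of R containing P, and let I = xR_P ∩ R. Then I R_M = I R_P ∩ R_M and I² R_M = x I R_M. -/

import Mathlib

open scoped nonZeroDivisors

section

variable {R : Type*} (K : Type*) [CommRing R] [IsDomain R] [Field K]
  [Algebra R K] [IsFractionRing R K]

/-- The `t`-operation on (nonzero) fractional ideals of `R`:
`I_t = ⋃ J_v`, where `J` ranges over the nonzero finitely generated subideals of `I` and
`J_v = (J⁻¹)⁻¹` (realized as a supremum of `R`-submodules of `K`). -/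
noncomputable def tOp (I : FractionalIdeal R⁰ K) : Submodule R K :=
  ⨆ (J : FractionalIdeal R⁰ K) (_ : J ≠ 0) (_ : J ≤ I) (_ : (J : Submodule R K).FG),
    (((J⁻¹)⁻¹ : FractionalIdeal R⁰ K) : Submodule R K)

/-- An integral ideal `M` of `R` is a `t`-ideal if `M_t = M`. -/
def IsTIdeal (M : Ideal R) : Prop :=
  tOp K (M : FractionalIdeal R⁰ K) = ((M : FractionalIdeal R⁰ K) : Submodule R K)

/-- `M` is a maximal `t`-ideal of `R`: maximal among the proper integral `t`-ideals. -/
def IsMaxTIdeal (M : Ideal R) : Prop :=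
  M ≠ ⊤ ∧ IsTIdeal K M ∧ ∀ N : Ideal R, N ≠ ⊤ → IsTIdeal K N → M ≤ N → M = N

/-- The extension `A·R_M` of an `R`-submodule `A` of `K` to the localization `R_M ⊆ K`
(for `M` a prime ideal of `R`): the set of fractions `a/t` with `a ∈ A`, `t ∉ M`. -/
noncomputable def locMul (M : Ideal R) (A : Submodule R K) : Submodule R K :=
  ⨆ (t : R) (_ : t ∉ M), Submodule.span R {(algebraMap R K t)⁻¹} * A

/-- The `w`-operation: `I_w = ⋂ I·R_M`, the intersection taken over all maximal `t`-ideals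
`M` of `R`. -/
noncomputable def wOp (I : FractionalIdeal R⁰ K) : Submodule R K :=
  ⨅ (M : Ideal R) (_ : IsMaxTIdeal K M), locMul K M (I : Submodule R K)

/-- `R` is a Prüfer `v`-multiplication domain: every nonzero finitely generated ideal is
`t`-invertible. -/
def IsPvMD : Prop :=
  ∀ I : Ideal R, I ≠ ⊥ → I.FG →
    tOp K ((I : FractionalIdeal R⁰ K) * (I : FractionalIdeal R⁰ K)⁻¹) = 1

end

/-- The ideal `x·R_P ∩ R` of `R`: the contraction to `R` of the extension of `xR` to the
localization `R_P ⊆ K`. -/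
noncomputable def contrLoc {R : Type*} (K : Type*) [CommRing R] [IsDomain R] [Field K]
    [Algebra R K] [IsFractionRing R K] (P : Ideal R) (x : R) : Ideal R :=
  (locMul K P (Submodule.map (Algebra.linearMap R K) (Ideal.span {x}))).comap
    (Algebra.linearMap R K)

section helpers

variable {R : Type*} {K : Type*} [CommRing R] [IsDomain R] [Field K]
  [Algebra R K] [IsFractionRing R K]

theorem mem_locMul_iff (Q : Ideal R) [hQ : Q.IsPrime] (A : Submodule R K) (y : K) :
    y ∈ locMul K Q A ↔ ∃ t : R, t ∉ Q ∧ algebraMap R K t * y ∈ A := by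
  constructor
  · let T : Submodule R K :=
      { carrier := {y | ∃ t : R, t ∉ Q ∧ algebraMap R K t * y ∈ A}
        zero_mem' := ⟨1, fun h => hQ.ne_top ((Ideal.eq_top_iff_one _).2 h), by simp⟩
        add_mem' := by
          rintro a b ⟨t, ht, hta⟩ ⟨s, hs, hsb⟩
          refine ⟨t * s, fun h => (hQ.mem_or_mem h).elim ht hs, ?_⟩
          have h1 := A.smul_mem s hta
          have h2 := A.smul_mem t hsb
          rw [Algebra.smul_def] at h1 h2
          have := A.add_mem h1 h2
          convert this using 1
          rw [map_mul]; ring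
        smul_mem' := by
          rintro c a ⟨t, ht, hta⟩
          refine ⟨t, ht, ?_⟩
          have h1 := A.smul_mem c hta
          rw [Algebra.smul_def] at h1 ⊢
          convert h1 using 1
          ring }
    have : locMul K Q A ≤ T := by
      refine iSup₂_le fun t ht => Submodule.mul_le.2 ?_
      intro m hm n hn
      obtain ⟨c, rfl⟩ := Submodule.mem_span_singleton.1 hm
      refine ⟨t, ht, ?_⟩
      have ht0 : algebraMap R K t ≠ 0 := by
        intro h
        rw [IsFractionRing.to_map_eq_zero_iff] at h
        exact ht (h ▸ Q.zero_mem)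
      have h1 := A.smul_mem c hn
      rw [Algebra.smul_def] at h1 ⊢
      convert h1 using 1
      field_simp
    exact fun h => this h
  · rintro ⟨t, ht, hty⟩
    have ht0 : algebraMap R K t ≠ 0 := by
      intro h
      rw [IsFractionRing.to_map_eq_zero_iff] at h
      exact ht (h ▸ Q.zero_mem)
    have h1 : y ∈ Submodule.span R {(algebraMap R K t)⁻¹} * A := by
      have := Submodule.mul_mem_mul (Submodule.mem_span_singleton_self (R := R)
        (algebraMap R K t)⁻¹) hty
      convert this using 1
      field_simp
    exact (le_iSup₂_of_le (f := fun (t : R) (_ : t ∉ Q) =>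
      Submodule.span R {(algebraMap R K t)⁻¹} * A) t ht le_rfl) h1

theorem mem_contrLoc_iff (P : Ideal R) [hP : P.IsPrime] (x r : R) :
    r ∈ contrLoc K P x ↔ ∃ s : R, s ∉ P ∧ ∃ c, s * r = x * c := by
  unfold contrLoc
  rw [Submodule.mem_comap, mem_locMul_iff]
  refine exists_congr fun s => and_congr_right fun _ => ?_
  simp only [Submodule.mem_map, Algebra.linearMap_apply, Ideal.mem_span_singleton]
  constructor
  · rintro ⟨z, ⟨c, rfl⟩, h⟩
    rw [← map_mul] at h
    exact ⟨c, (IsFractionRing.injective R K h).symm⟩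
  · rintro ⟨c, h⟩
    exact ⟨x * c, ⟨c, rfl⟩, by rw [← h, map_mul]⟩

theorem tOp_mono {I J : FractionalIdeal R⁰ K} (h : I ≤ J) : tOp K I ≤ tOp K J := by
  refine iSup_le fun A => iSup_le fun h0 => iSup_le fun hA => iSup_le fun hfg => ?_
  exact le_iSup_of_le A (le_iSup_of_le h0 (le_iSup_of_le (hA.trans h)
    (le_iSup_of_le hfg le_rfl)))

theorem mem_tOp {I J : FractionalIdeal R⁰ K} (h0 : J ≠ 0) (h : J ≤ I)
    (hfg : (J : Submodule R K).FG) {y : K} (hy : y ∈ (J⁻¹)⁻¹) : y ∈ tOp K I := by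
  have : (((J⁻¹)⁻¹ : FractionalIdeal R⁰ K) : Submodule R K) ≤ tOp K I :=
    le_iSup_of_le J (le_iSup_of_le h0 (le_iSup_of_le h (le_iSup_of_le hfg le_rfl)))
  exact this hy

theorem inv_ne_zero_of_le_one {J : FractionalIdeal R⁰ K} (h0 : J ≠ 0) (h : J ≤ 1) :
    (1 : K) ∈ J⁻¹ ∧ J⁻¹ ≠ 0 := by
  have h1 : (1 : K) ∈ J⁻¹ := by
    rw [FractionalIdeal.mem_inv_iff h0]
    intro y hy
    rw [one_mul]; exact h hy
  refine ⟨h1, fun h2 => ?_⟩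
  rw [h2, FractionalIdeal.mem_zero_iff] at h1
  exact one_ne_zero h1

theorem isPrime_of_isMaxTIdeal {M : Ideal R} (hM : IsMaxTIdeal K M) : M.IsPrime := by
  obtain ⟨hne, ht, hmax⟩ := hM
  refine ⟨hne, ?_⟩
  intro a b hab
  by_contra hcon
  push Not at hcon
  obtain ⟨ha, hb⟩ := hcon
  have ha0 : a ≠ 0 := fun h => ha (h ▸ M.zero_mem)
  have haK : algebraMap R K a ≠ 0 := by
    rwa [Ne, IsFractionRing.to_map_eq_zero_iff]
  let N : Ideal R :=
    { carrier := {r | a * r ∈ M}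
      zero_mem' := by simp
      add_mem' := by
        intro r s hr hs
        simp only [Set.mem_setOf_eq] at *
        rw [mul_add]; exact M.add_mem hr hs
      smul_mem' := by
        intro c r hr
        simp only [Set.mem_setOf_eq, smul_eq_mul] at *
        rw [mul_left_comm]; exact M.mul_mem_left c hr }
  have hNmem : ∀ r, r ∈ N ↔ a * r ∈ M := fun r => Iff.rfl
  have hN1 : N ≠ ⊤ := by
    intro h
    have := (Ideal.eq_top_iff_one _).1 h
    rw [hNmem, mul_one] at this
    exact ha this
  have hMN : M ≤ N := fun r hr => M.mul_mem_left a hr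
  have hNt : IsTIdeal K N := by
    apply le_antisymm
    · refine iSup_le fun J => iSup_le fun h0 => iSup_le fun hJ => iSup_le fun hfg => ?_
      intro y hy
      change y ∈ (J⁻¹)⁻¹ at hy
      change y ∈ (N : FractionalIdeal R⁰ K)
      have hJ1 : J ≤ 1 := hJ.trans FractionalIdeal.coeIdeal_le_one
      obtain ⟨hone, hinv⟩ := inv_ne_zero_of_le_one h0 hJ1
      rw [FractionalIdeal.mem_inv_iff hinv] at hy
      have hy1 := hy 1 hone
      rw [mul_one, FractionalIdeal.mem_one_iff] at hy1
      obtain ⟨r, rfl⟩ := hy1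
      have hJ'0 : FractionalIdeal.spanSingleton R⁰ (algebraMap R K a) * J ≠ 0 := by
        intro h
        apply h0
        rw [← one_mul J, ← FractionalIdeal.spanSingleton_inv_mul K haK, mul_assoc, h, mul_zero]
      have hJ'M : FractionalIdeal.spanSingleton R⁰ (algebraMap R K a) * J ≤ M := by
        intro z hz
        obtain ⟨w, hw, rfl⟩ := FractionalIdeal.mem_singleton_mul.1 hz
        obtain ⟨n, hn, rfl⟩ := (FractionalIdeal.mem_coeIdeal _).1 (hJ hw)
        exact (FractionalIdeal.mem_coeIdeal _).2 ⟨a * n, hn, map_mul _ _ _⟩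
      have hJ'fg : ((FractionalIdeal.spanSingleton R⁰ (algebraMap R K a) * J :
          FractionalIdeal R⁰ K) : Submodule R K).FG := by
        rw [FractionalIdeal.coe_mul, FractionalIdeal.coe_spanSingleton]
        exact (Submodule.fg_span_singleton _).mul hfg
      obtain ⟨-, hinv'⟩ := inv_ne_zero_of_le_one hJ'0
        (hJ'M.trans FractionalIdeal.coeIdeal_le_one)
      have hmem : algebraMap R K (a * r) ∈ tOp K (M : FractionalIdeal R⁰ K) := by
        refine mem_tOp hJ'0 hJ'M hJ'fg ?_
        rw [FractionalIdeal.mem_inv_iff hinv']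
        intro u hu
        rw [FractionalIdeal.mem_inv_iff hJ'0] at hu
        have h2 : algebraMap R K a * u ∈ J⁻¹ := by
          rw [FractionalIdeal.mem_inv_iff h0]
          intro j hj
          have := hu _ (FractionalIdeal.mem_singleton_mul.2 ⟨j, hj, rfl⟩)
          convert this using 1
          ring
        have := hy _ h2
        convert this using 1
        rw [map_mul]; ring
      rw [ht] at hmem
      change algebraMap R K (a * r) ∈ (M : FractionalIdeal R⁰ K) at hmem
      obtain ⟨m, hm, hmr⟩ := (FractionalIdeal.mem_coeIdeal _).1 hmem
      have := IsFractionRing.injective R K hmr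
      exact (FractionalIdeal.mem_coeIdeal _).2 ⟨r, by rw [hNmem, ← this]; exact hm, rfl⟩
    · intro y hy
      change y ∈ (N : FractionalIdeal R⁰ K) at hy
      by_cases hy0 : y = 0
      · rw [hy0]; exact Submodule.zero_mem _
      · refine mem_tOp (J := FractionalIdeal.spanSingleton R⁰ y) ?_ ?_ ?_ ?_
        · rwa [Ne, FractionalIdeal.spanSingleton_eq_zero_iff]
        · exact FractionalIdeal.spanSingleton_le_iff_mem.2 hy
        · rw [FractionalIdeal.coe_spanSingleton]
          exact Submodule.fg_span_singleton _
        · rw [FractionalIdeal.spanSingleton_inv, FractionalIdeal.spanSingleton_inv, inv_inv]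
          exact FractionalIdeal.mem_spanSingleton_self _ _
  have := hmax N hN1 hNt hMN
  apply hb
  rw [this]
  exact hab

theorem key_val (hpvmd : IsPvMD (R := R) K) {M : Ideal R} (hM : IsMaxTIdeal K M)
    (a b : R) (ha : a ≠ 0) :
    ∃ s r : R, s ∉ M ∧ (b * s = a * r ∨ a * s = b * r) := by
  obtain ⟨hne, ht, -⟩ := hM
  let J : Ideal R := Ideal.span {a, b}
  have haJ : a ∈ J := Ideal.subset_span (by simp)
  have hbJ : b ∈ J := Ideal.subset_span (by simp)
  have hJ0 : J ≠ ⊥ := by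
    intro h
    rw [h] at haJ
    exact ha haJ
  have hJ0' : (J : FractionalIdeal R⁰ K) ≠ 0 := FractionalIdeal.coeIdeal_ne_zero.2 hJ0
  have hJ := hpvmd J hJ0 (Submodule.fg_span (Set.toFinite _))
  by_contra hcon
  push Not at hcon
  have hint : ∀ u ∈ (J : FractionalIdeal R⁰ K)⁻¹, ∀ c ∈ J,
      ∃ d, algebraMap R K d = algebraMap R K c * u := by
    intro u hu c hc
    rw [FractionalIdeal.mem_inv_iff hJ0'] at hu
    obtain ⟨d, hd⟩ := (FractionalIdeal.mem_one_iff _).1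
      (hu _ ((FractionalIdeal.mem_coeIdeal _).2 ⟨c, hc, rfl⟩))
    exact ⟨d, by rw [hd, mul_comm]⟩
  have hle : (J : FractionalIdeal R⁰ K) * (J : FractionalIdeal R⁰ K)⁻¹ ≤ M := by
    rw [FractionalIdeal.mul_le]
    intro i hi u hu
    obtain ⟨c, hc, rfl⟩ := (FractionalIdeal.mem_coeIdeal _).1 hi
    obtain ⟨α, hα⟩ := hint u hu a haJ
    obtain ⟨β, hβ⟩ := hint u hu b hbJ
    have hαM : α ∈ M := by
      by_contra h
      refine (hcon α β h).1 (IsFractionRing.injective R K ?_)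
      rw [map_mul, map_mul, hα, hβ]; ring
    have hβM : β ∈ M := by
      by_contra h
      refine (hcon β α h).2 (IsFractionRing.injective R K ?_)
      rw [map_mul, map_mul, hα, hβ]; ring
    obtain ⟨p, q, rfl⟩ := Ideal.mem_span_pair.1 hc
    refine (FractionalIdeal.mem_coeIdeal _).2 ⟨p * α + q * β,
      M.add_mem (M.mul_mem_left _ hαM) (M.mul_mem_left _ hβM), ?_⟩
    simp only [map_add, map_mul, hα, hβ]; ring
  have h1 := tOp_mono hle
  rw [hJ, ht] at h1
  have h2 : (1 : K) ∈ (M : FractionalIdeal R⁰ K) := h1 (Submodule.one_le.1 le_rfl)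
  obtain ⟨m, hm, hm1⟩ := (FractionalIdeal.mem_coeIdeal _).1 h2
  rw [← map_one (algebraMap R K)] at hm1
  have := IsFractionRing.injective R K hm1
  exact hne ((Ideal.eq_top_iff_one _).2 (this ▸ hm))

end helpers

/-- Let `R` be a PvMD (not a field), `x` a nonzero nonunit, `P` a prime minimal over `xR`,
`M` a maximal `t`-ideal containing `P`, and `I = xR_P ∩ R`.  Then `I R_M = I R_P ∩ R_M` and
`I² R_M = x·I R_M` (as `R`-submodules of the quotient field `K`). -/
theorem loc_eq_of_contraction
    {R K : Type*} [CommRing R] [IsDomain R] [Field K] [Algebra R K] [IsFractionRing R K]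
    (hnf : ¬ IsField R) (hpvmd : IsPvMD (R := R) K)
    (x : R) (hx0 : x ≠ 0) (hxu : ¬ IsUnit x)
    (P : Ideal R) (hP : P ∈ (Ideal.span {x} : Ideal R).minimalPrimes)
    (M : Ideal R) (hM : IsMaxTIdeal K M) (hPM : P ≤ M) :
    locMul K M (Submodule.map (Algebra.linearMap R K) (contrLoc K P x))
        = locMul K P (Submodule.map (Algebra.linearMap R K) (contrLoc K P x))
            ⊓ locMul K M (1 : Submodule R K)
      ∧ locMul K M (Submodule.map (Algebra.linearMap R K) (contrLoc K P x ^ 2))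
        = Submodule.span R {algebraMap R K x}
            * locMul K M (Submodule.map (Algebra.linearMap R K) (contrLoc K P x)) := by
  haveI hMp : M.IsPrime := isPrime_of_isMaxTIdeal hM
  haveI hPp : P.IsPrime := hP.1.1
  have hxP : x ∈ P := hP.1.2 (Ideal.mem_span_singleton_self x)
  have hinj := IsFractionRing.injective R K
  have hsat : ∀ s r : R, s ∉ P → s * r ∈ contrLoc K P x → r ∈ contrLoc K P x := by
    intro s r hs h
    obtain ⟨s', hs', c, hc⟩ := (mem_contrLoc_iff P x _).1 h
    exact (mem_contrLoc_iff P x _).2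
      ⟨s' * s, fun h => (hPp.mem_or_mem h).elim hs' hs, c, by rw [← hc, mul_assoc]⟩
  have hIP : ∀ r ∈ contrLoc K P x, r ∈ P := by
    intro r hr
    obtain ⟨s, hs, c, hc⟩ := (mem_contrLoc_iff P x _).1 hr
    have : s * r ∈ P := hc ▸ P.mul_mem_right c hxP
    exact (hPp.mem_or_mem this).resolve_left hs
  have hxI : x ∈ contrLoc K P x :=
    (mem_contrLoc_iff P x _).2
      ⟨1, fun h => hPp.ne_top ((Ideal.eq_top_iff_one _).2 h), 1, mul_comm _ _⟩
  -- the key fact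
  have hkey : ∀ a ∈ contrLoc K P x, ∀ b ∈ contrLoc K P x,
      ∃ t, t ∉ M ∧ ∃ d ∈ contrLoc K P x, t * (a * b) = x * d := by
    intro a ha b hb
    by_cases ha0 : a = 0
    · exact ⟨1, fun h => hMp.ne_top ((Ideal.eq_top_iff_one _).2 h), 0, Ideal.zero_mem _,
        by simp [ha0]⟩
    obtain ⟨t, r, ht, h | h⟩ := key_val hpvmd hM x a hx0
    · exact ⟨t, ht, r * b, Ideal.mul_mem_left _ _ hb, by linear_combination b * h⟩
    · obtain ⟨s, hs, c, hc⟩ := (mem_contrLoc_iff P x _).1 ha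
      have hst : s * t = r * c := by
        apply mul_left_cancel₀ ha0
        linear_combination t * hc + c * h
      have hrP : r ∉ P := by
        intro hr
        have : s * t ∈ P := hst ▸ P.mul_mem_right c hr
        exact (hPp.mem_or_mem this).elim hs (fun h => ht (hPM h))
      have hr0 : r ≠ 0 := fun h => hrP (h ▸ P.zero_mem)
      obtain ⟨t', d, ht', h' | h'⟩ := key_val hpvmd hM r b hr0
      · have hd : d ∈ contrLoc K P x :=
          hsat r d hrP (h' ▸ Ideal.mul_mem_right _ _ hb)
        refine ⟨t', ht', t * d, Ideal.mul_mem_left _ _ hd, ?_⟩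
        apply mul_left_cancel₀ hr0
        linear_combination (-(t' * b)) * h + x * t * h'
      · exfalso
        have : r * t' ∈ P := h' ▸ P.mul_mem_right d (hIP b hb)
        exact (hPp.mem_or_mem this).elim hrP (fun h => ht' (hPM h))
  constructor
  · ext y
    rw [Submodule.mem_inf, mem_locMul_iff, mem_locMul_iff, mem_locMul_iff]
    constructor
    · rintro ⟨t, ht, h⟩
      refine ⟨⟨t, fun h => ht (hPM h), h⟩, t, ht, ?_⟩
      obtain ⟨r, -, hr⟩ := h
      exact Submodule.mem_one.2 ⟨r, hr⟩
    · rintro ⟨⟨s, hs, i, hi, hiy⟩, t, ht, h⟩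
      obtain ⟨r, hr⟩ := Submodule.mem_one.1 h
      refine ⟨t, ht, r, hsat s r hs ?_, hr⟩
      have : s * r = t * i := by
        apply hinj
        rw [Algebra.linearMap_apply] at hiy
        rw [map_mul, map_mul, hr, hiy]; ring
      rw [this]
      exact Ideal.mul_mem_left _ _ hi
  · apply le_antisymm
    · intro y hy
      obtain ⟨t, ht, i, hi, hiy⟩ := (mem_locMul_iff M _ y).1 hy
      have hall : ∀ i ∈ contrLoc K P x ^ 2,
          ∃ t, t ∉ M ∧ ∃ d ∈ contrLoc K P x, t * i = x * d := by
        intro i hi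
        rw [pow_two] at hi
        refine Submodule.mul_induction_on hi hkey ?_
        rintro p q ⟨t, ht, d, hd, h⟩ ⟨t', ht', d', hd', h'⟩
        refine ⟨t * t', fun h => (hMp.mem_or_mem h).elim ht ht', t' * d + t * d',
          Ideal.add_mem _ (Ideal.mul_mem_left _ _ hd) (Ideal.mul_mem_left _ _ hd'), ?_⟩
        linear_combination t' * h + t * h'
      obtain ⟨t', ht', d, hd, h⟩ := hall i hi
      have hxK : algebraMap R K x ≠ 0 := by
        rwa [Ne, IsFractionRing.to_map_eq_zero_iff]
      have hz : (algebraMap R K x)⁻¹ * y ∈ locMul K M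
          (Submodule.map (Algebra.linearMap R K) (contrLoc K P x)) := by
        rw [mem_locMul_iff]
        refine ⟨t' * t, fun h => (hMp.mem_or_mem h).elim ht' ht, d, hd, ?_⟩
        rw [Algebra.linearMap_apply] at hiy ⊢
        have h2 := congrArg (algebraMap R K) h
        rw [map_mul, map_mul, hiy] at h2
        rw [map_mul]
        field_simp
        linear_combination -h2
      have := Submodule.mul_mem_mul
        (Submodule.mem_span_singleton_self (R := R) (algebraMap R K x)) hz
      rwa [mul_inv_cancel_left₀ hxK] at this
    · rw [Submodule.mul_le]
      intro m hm z hz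
      obtain ⟨c, rfl⟩ := Submodule.mem_span_singleton.1 hm
      obtain ⟨t, ht, i, hi, hiz⟩ := (mem_locMul_iff M _ z).1 hz
      rw [mem_locMul_iff]
      refine ⟨t, ht, c * (x * i), Ideal.mul_mem_left _ _ ?_, ?_⟩
      · rw [pow_two]; exact Ideal.mul_mem_mul hxI hi
      · rw [Algebra.linearMap_apply] at hiz ⊢
        rw [map_mul, map_mul, hiz, Algebra.smul_def]; ring
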